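/- arXiv:1501.04781 — 3 statements merged into one kernel-verified Lean document; each statement's English description precedes it below -/
import Mathlib

section
/- Fix integers n and n₁ with 1 ≤ n₁ < n. For each natural number k let M_k be the set of all polynomials ∏_{1≤i≤n₁, n₁+1≤t≤n} (x_i x_t)^{p_{it}} where the p_{it} are natural numbers with ∑_{1≤i≤n₁, n₁+1≤t≤n} p_{it} = k. Then the dimension of the ℂ-linear span of M_k equals C(n₁+k−1, k)·C(n−n₁+k−1, k) (binomial coefficients); consequently there exist positive real constants c₁, c₂ such that c₁·k^{n−2} ≤ dim Span M_k ≤ c₂·k^{n−2} for all integers k ≥ 1. -/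
open MvPolynomial

/-- The variable `xᵢ` in `ℂ[x₁,…,xₙ,y₁,…,yₙ]` (indices `0,…,n-1` stand for `1,…,n`). -/
noncomputable def xx (n : ℕ) (i : Fin n) : MvPolynomial (Fin n ⊕ Fin n) ℂ := X (Sum.inl i)

/-- The variable `yᵢ` in `ℂ[x₁,…,xₙ,y₁,…,yₙ]`. -/
noncomputable def yy (n : ℕ) (i : Fin n) : MvPolynomial (Fin n ⊕ Fin n) ℂ := X (Sum.inr i)

/-- The set `M_k` of products `∏_{1≤i≤n₁, n₁+1≤t≤n} (xᵢ x_t)^{p_{it}}` with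
`∑ p_{it} = k` (indices written 0-based: `i.val < n₁` and `n₁ ≤ t.val`). -/
noncomputable def Mset (n n₁ k : ℕ) : Set (MvPolynomial (Fin n ⊕ Fin n) ℂ) :=
  { P | ∃ p : Fin n → Fin n → ℕ,
      (∑ i : Fin n, ∑ t : Fin n, if i.val < n₁ ∧ n₁ ≤ t.val then p i t else 0) = k ∧
      P = ∏ i : Fin n, ∏ t : Fin n,
        if i.val < n₁ ∧ n₁ ≤ t.val then (xx n i * xx n t) ^ p i t else 1 }

/-- The monomial attached to a pair of multisets of indices. -/
noncomputable def pairMon (a m k : ℕ) (st : Sym (Fin a) k × Sym (Fin m) k) :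
    MvPolynomial (Fin (a + m) ⊕ Fin (a + m)) ℂ :=
  (st.1.1.map (fun i => xx (a + m) (Fin.castAdd m i))).prod *
    (st.2.1.map (fun t => xx (a + m) (Fin.natAdd a t))).prod

lemma prod_map_X_eq {σ α : Type*} [DecidableEq σ] (f : α → σ) (s : Multiset α) :
    (s.map (fun i => (X (f i) : MvPolynomial σ ℂ))).prod =
      monomial (Multiset.toFinsupp (s.map f)) 1 := by
  induction s using Multiset.induction_on with
  | empty => simp
  | cons a s ih =>
    rw [Multiset.map_cons, Multiset.prod_cons, ih, Multiset.map_cons, ← Multiset.singleton_add,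
      map_add, Multiset.toFinsupp_singleton, X, monomial_mul, one_mul]

lemma pairMon_eq (a m k : ℕ) (st : Sym (Fin a) k × Sym (Fin m) k) :
    pairMon a m k st = monomial (Multiset.toFinsupp
      (st.1.1.map (fun i => (Sum.inl (Fin.castAdd m i) : Fin (a + m) ⊕ Fin (a + m))) +
        st.2.1.map (fun t => Sum.inl (Fin.natAdd a t)))) 1 := by
  unfold pairMon xx
  rw [prod_map_X_eq, prod_map_X_eq, monomial_mul, one_mul, map_add]

lemma exps_injective (a m k : ℕ) : Function.Injective
    (fun st : Sym (Fin a) k × Sym (Fin m) k => Multiset.toFinsupp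
      (st.1.1.map (fun i => (Sum.inl (Fin.castAdd m i) : Fin (a + m) ⊕ Fin (a + m))) +
        st.2.1.map (fun t => Sum.inl (Fin.natAdd a t)))) := by
  rintro ⟨s, t⟩ ⟨s', t'⟩ h
  have h' := Multiset.toFinsupp.injective h
  have hf : Function.Injective
      (fun i => (Sum.inl (Fin.castAdd m i) : Fin (a + m) ⊕ Fin (a + m))) := by
    intro i j hij
    simpa using hij
  have hg : Function.Injective
      (fun i => (Sum.inl (Fin.natAdd a i) : Fin (a + m) ⊕ Fin (a + m))) := by
    intro i j hij
    simpa using hij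
  have n1 : ∀ (u : Multiset (Fin m)) (i : Fin a),
      (Sum.inl (Fin.castAdd m i) : Fin (a + m) ⊕ Fin (a + m)) ∉
        u.map (fun t => Sum.inl (Fin.natAdd a t)) := by
    intro u i hi
    simp only [Multiset.mem_map, Sum.inl.injEq] at hi
    obtain ⟨j, _, hj⟩ := hi
    have := congrArg Fin.val hj
    simp at this
    omega
  have n2 : ∀ (u : Multiset (Fin a)) (i : Fin m),
      (Sum.inl (Fin.natAdd a i) : Fin (a + m) ⊕ Fin (a + m)) ∉
        u.map (fun t => Sum.inl (Fin.castAdd m t)) := by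
    intro u i hi
    simp only [Multiset.mem_map, Sum.inl.injEq] at hi
    obtain ⟨j, _, hj⟩ := hi
    have := congrArg Fin.val hj
    simp at this
    omega
  refine Prod.ext (Subtype.ext (Multiset.ext.2 fun i => ?_))
    (Subtype.ext (Multiset.ext.2 fun i => ?_))
  · have := congrArg (Multiset.count (Sum.inl (Fin.castAdd m i))) h'
    simp only [Multiset.count_add] at this
    rw [Multiset.count_eq_zero_of_notMem (n1 _ _), Multiset.count_eq_zero_of_notMem (n1 _ _),
      add_zero, add_zero] at this
    rwa [Multiset.count_map_eq_count' _ _ hf, Multiset.count_map_eq_count' _ _ hf] at this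
  · have := congrArg (Multiset.count (Sum.inl (Fin.natAdd a i))) h'
    simp only [Multiset.count_add] at this
    rw [Multiset.count_eq_zero_of_notMem (n2 _ _), Multiset.count_eq_zero_of_notMem (n2 _ _),
      zero_add, zero_add] at this
    rwa [Multiset.count_map_eq_count' _ _ hg, Multiset.count_map_eq_count' _ _ hg] at this

lemma pairMon_linInd (a m k : ℕ) : LinearIndependent ℂ (pairMon a m k) := by
  have h := (basisMonomials (Fin (a + m) ⊕ Fin (a + m)) ℂ).linearIndependent.comp _
    (exps_injective a m k)
  have e : pairMon a m k = (basisMonomials (Fin (a + m) ⊕ Fin (a + m)) ℂ) ∘ (fun st =>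
      Multiset.toFinsupp
      (st.1.1.map (fun i => (Sum.inl (Fin.castAdd m i) : Fin (a + m) ⊕ Fin (a + m))) +
        st.2.1.map (fun t => Sum.inl (Fin.natAdd a t)))) := by
    funext st
    rw [pairMon_eq]
    exact (congrFun (coe_basisMonomials (Fin (a + m) ⊕ Fin (a + m)) ℂ) _).symm
  rw [e]
  exact h

/-- Any two multisets of the same size are the marginals of a multiset of pairs. -/
lemma exists_coupling {α β : Type*} (k : ℕ) (s : Multiset α) (t : Multiset β)
    (hs : s.card = k) (ht : t.card = k) :
    ∃ Z : Multiset (α × β), Z.map Prod.fst = s ∧ Z.map Prod.snd = t := by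
  induction s using Quotient.inductionOn with | _ l =>
  induction t using Quotient.inductionOn with | _ r =>
  have e : l.length = r.length := by
    simpa using hs.trans ht.symm
  refine ⟨(l.zip r : List (α × β)), ?_, ?_⟩
  · simp [List.map_fst_zip e.le]
  · simp [List.map_snd_zip e.ge]

lemma sum_split (a m : ℕ) (p : Fin (a + m) → Fin (a + m) → ℕ) :
    (∑ i : Fin (a + m), ∑ t : Fin (a + m), if i.val < a ∧ a ≤ t.val then p i t else 0) =
      ∑ i : Fin a, ∑ t : Fin m, p (Fin.castAdd m i) (Fin.natAdd a t) := by
  have h : ∀ t : Fin a, ¬ a ≤ t.val := fun t => by omega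
  simp [Fin.sum_univ_add, h]

lemma prod_split {R : Type*} [CommMonoid R] (a m : ℕ) (p : Fin (a + m) → Fin (a + m) → R) :
    (∏ i : Fin (a + m), ∏ t : Fin (a + m), if i.val < a ∧ a ≤ t.val then p i t else 1) =
      ∏ i : Fin a, ∏ t : Fin m, p (Fin.castAdd m i) (Fin.natAdd a t) := by
  have h : ∀ t : Fin a, ¬ a ≤ t.val := fun t => by omega
  simp [Fin.prod_univ_add, h]

lemma prod_count {R : Type*} [CommMonoid R] (a m : ℕ) (Z : Multiset (Fin a × Fin m))
    (f : Fin a → Fin m → R) :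
    ∏ i : Fin a, ∏ t : Fin m, f i t ^ Z.count (i, t) = (Z.map (fun z => f z.1 z.2)).prod := by
  rw [Finset.prod_multiset_map_count, ← Fintype.prod_prod_type'
    (f := fun i t => f i t ^ Z.count (i, t))]
  symm
  apply Finset.prod_subset (Finset.subset_univ _)
  intro z _ hz
  rw [Multiset.count_eq_zero_of_notMem (by simpa using hz), pow_zero]

lemma sum_count (a m : ℕ) (Z : Multiset (Fin a × Fin m)) :
    ∑ i : Fin a, ∑ t : Fin m, Z.count (i, t) = Z.card := by
  rw [← Fintype.sum_prod_type' (f := fun i t => Z.count (i, t))]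
  exact Multiset.sum_count_eq_card (by simp)

lemma Mset_eq (a m k : ℕ) : Mset (a + m) a k = Set.range (pairMon a m k) := by
  ext P
  constructor
  · rintro ⟨p, hp, rfl⟩
    rw [sum_split] at hp
    rw [prod_split a m (fun i t => (xx (a + m) i * xx (a + m) t) ^ p i t)]
    obtain ⟨Z, hZ⟩ : ∃ Z : Multiset (Fin a × Fin m), ∀ i t,
        Z.count (i, t) = p (Fin.castAdd m i) (Fin.natAdd a t) :=
      ⟨Finsupp.toMultiset (Finsupp.equivFunOnFinite.symm
        fun z => p (Fin.castAdd m z.1) (Fin.natAdd a z.2)), by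
        intro i t
        simp⟩
    simp only [← hZ] at hp ⊢
    rw [sum_count] at hp
    refine ⟨(⟨Z.map Prod.fst, by simpa using hp⟩, ⟨Z.map Prod.snd, by simpa using hp⟩), ?_⟩
    rw [prod_count a m Z (fun i t => xx (a + m) (Fin.castAdd m i) * xx (a + m) (Fin.natAdd a t))]
    simp [pairMon, Multiset.prod_map_mul, Multiset.map_map]
  · rintro ⟨⟨⟨s, hs⟩, ⟨t, ht⟩⟩, rfl⟩
    obtain ⟨Z, rfl, rfl⟩ := exists_coupling k s t hs ht
    set p : Fin (a + m) → Fin (a + m) → ℕ := fun i t =>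
      if h : i.val < a ∧ a ≤ t.val then
        Z.count (⟨i.val, h.1⟩, ⟨t.val - a, by omega⟩) else 0 with hpdef
    have hp : ∀ i t, p (Fin.castAdd m i) (Fin.natAdd a t) = Z.count (i, t) := by
      intro i t
      simp [hpdef]
    refine ⟨p, ?_, ?_⟩
    · rw [sum_split]
      simp only [hp]
      rw [sum_count]
      simpa using hs
    · rw [prod_split a m (fun i t => (xx (a + m) i * xx (a + m) t) ^ p i t)]
      simp only [hp]
      rw [prod_count a m Z
        (fun i t => xx (a + m) (Fin.castAdd m i) * xx (a + m) (Fin.natAdd a t))]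
      simp [pairMon, Multiset.prod_map_mul, Multiset.map_map]

lemma finrank_Mset (a m k : ℕ) : Module.finrank ℂ ↥(Submodule.span ℂ (Mset (a + m) a k)) =
    Nat.choose (a + k - 1) k * Nat.choose (m + k - 1) k := by
  rw [Mset_eq, finrank_span_eq_card (pairMon_linInd a m k), Fintype.card_prod,
    Sym.card_sym_eq_choose, Sym.card_sym_eq_choose, Fintype.card_fin, Fintype.card_fin]

lemma choose_bounds (d k : ℕ) (hk : 1 ≤ k) :
    (1 / (d.factorial : ℝ)) * (k : ℝ) ^ d ≤ (Nat.choose (d + 1 + k - 1) k : ℝ) ∧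
    (Nat.choose (d + 1 + k - 1) k : ℝ) ≤ ((d : ℝ) + 1) ^ d * (k : ℝ) ^ d := by
  have e : Nat.choose (d + 1 + k - 1) k = Nat.choose (k + d) d := by
    rw [show d + 1 + k - 1 = k + d by omega, Nat.choose_symm_add]
  rw [e]
  constructor
  · have h := Nat.pow_le_choose (α := ℝ) d (k + d)
    have h0 : (k : ℝ) ^ d ≤ ((k + d + 1 - d : ℕ) : ℝ) ^ d := by
      gcongr
      omega
    rw [one_div, inv_mul_eq_div]
    refine le_trans ?_ h
    gcongr
  · have h : Nat.choose (k + d) d ≤ (k + d) ^ d := Nat.choose_le_pow _ _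
    have h' : (k + d) ^ d ≤ ((d + 1) * k) ^ d := by
      gcongr
      nlinarith
    have := h.trans h'
    rw [mul_pow] at this
    exact_mod_cast this

theorem statement0 (n n₁ : ℕ) (h1 : 1 ≤ n₁) (h2 : n₁ < n) :
    (∀ k : ℕ, Module.finrank ℂ ↥(Submodule.span ℂ (Mset n n₁ k)) =
      Nat.choose (n₁ + k - 1) k * Nat.choose (n - n₁ + k - 1) k) ∧
    (∃ c₁ c₂ : ℝ, 0 < c₁ ∧ 0 < c₂ ∧ ∀ k : ℕ, 1 ≤ k →
      c₁ * (k : ℝ) ^ (n - 2) ≤ (Module.finrank ℂ ↥(Submodule.span ℂ (Mset n n₁ k)) : ℝ) ∧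
      (Module.finrank ℂ ↥(Submodule.span ℂ (Mset n n₁ k)) : ℝ) ≤ c₂ * (k : ℝ) ^ (n - 2)) := by
  obtain ⟨d, rfl⟩ : ∃ d, n₁ = d + 1 := ⟨n₁ - 1, by omega⟩
  obtain ⟨e, rfl⟩ : ∃ e, n = (d + 1) + (e + 1) := ⟨n - (d + 1) - 1, by omega⟩
  simp only [finrank_Mset, Nat.add_sub_cancel_left]
  refine ⟨fun _ => trivial, (1 / (d.factorial : ℝ)) * (1 / (e.factorial : ℝ)),
    ((d : ℝ) + 1) ^ d * ((e : ℝ) + 1) ^ e, by positivity, by positivity, fun k hk => ?_⟩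
  obtain ⟨a1, a2⟩ := choose_bounds d k hk
  obtain ⟨b1, b2⟩ := choose_bounds e k hk
  rw [show d + 1 + (e + 1) - 2 = d + e by omega, pow_add, Nat.cast_mul]
  constructor
  · rw [mul_mul_mul_comm]
    exact mul_le_mul a1 b1 (by positivity) (by positivity)
  · rw [mul_mul_mul_comm]
    exact mul_le_mul a2 b2 (by positivity) (by positivity)
end

section
/- Let R = ℂ[z₁,…,z_N] be a polynomial ring, let z be one fixed variable among z₁,…,z_N, and fix the lexicographic monomial order in which z is the greatest variable. Let I be a finite index set and for each i ∈ I let f_i and g_i be monomials of degree 2 in R. Suppose I is partitioned as I = I₁ ⊔ I₂ where: for every i ∈ I₁, z divides f_i and z does not divide g_i; and for every i ∈ I₂, z divides g_i and z does not divide f_i. Fix a natural number k and let P be the set of all products ∏_{i∈I} (f_i − g_i)^{a_i} with natural numbers a_i satisfying ∑_{i∈I} a_i = k. Then the dimension over ℂ of the linear span of P is at least the cardinality of the set of monomials { ∏_{i∈I₁} f_i^{a_i} · ∏_{i∈I₂} g_i^{a_i} : a_i ∈ ℕ, ∑_{i∈I} a_i = k }. (Indeed, ± ∏_{i∈I₁}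 f_i^{a_i} · ∏_{i∈I₂} g_i^{a_i} is the leading monomial of ∏_{i∈I}(f_i − g_i)^{a_i} with respect to this lexicographic order, and polynomials with pairwise distinct leading monomials are linearly independent.) -/
open MvPolynomial

/-- A polynomial is a *monomial of degree 2*: it equals `monomial d 1` for some
exponent vector `d` of total degree 2. -/
def IsDeg2Monomial {N : ℕ} (f : MvPolynomial (Fin N) ℂ) : Prop :=
  ∃ d : Fin N →₀ ℕ, f = monomial d 1 ∧ (d.sum fun _ e => e) = 2

/-- `P` has a unique monomial of largest `z`-exponent, namely `q`. -/
def HasLead {N : ℕ} (z : Fin N) (P : MvPolynomial (Fin N) ℂ) (q : Fin N →₀ ℕ) : Prop :=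
  coeff q P ≠ 0 ∧ ∀ m, coeff m P ≠ 0 → m = q ∨ m z < q z

theorem HasLead.mul {N : ℕ} {z : Fin N} {P P' : MvPolynomial (Fin N) ℂ} {q q' : Fin N →₀ ℕ}
    (h : HasLead z P q) (h' : HasLead z P' q') : HasLead z (P * P') (q + q') := by
  classical
  refine ⟨?_, ?_⟩
  · rw [coeff_mul, Finset.sum_eq_single (q, q')]
    · exact mul_ne_zero h.1 h'.1
    · rintro ⟨m, m'⟩ hm hne
      rw [Finset.HasAntidiagonal.mem_antidiagonal] at hm
      by_contra hc
      have h3 := h.2 m (left_ne_zero_of_mul hc)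
      have h4 := h'.2 m' (right_ne_zero_of_mul hc)
      have hz : m z + m' z = q z + q' z := by
        have := DFunLike.congr_fun hm z
        simpa using this
      rcases h3 with h3 | h3
      · rcases h4 with h4 | h4
        · exact hne (by rw [h3, h4])
        · rw [h3] at hz; omega
      · rcases h4 with h4 | h4
        · rw [h4] at hz; omega
        · omega
    · intro hn
      refine absurd ?_ hn
      rw [Finset.HasAntidiagonal.mem_antidiagonal]
  · intro m hm
    rw [coeff_mul] at hm
    obtain ⟨⟨a, b⟩, hab, hne⟩ := Finset.exists_ne_zero_of_sum_ne_zero hm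
    rw [Finset.HasAntidiagonal.mem_antidiagonal] at hab
    have h3 := h.2 a (left_ne_zero_of_mul hne)
    have h4 := h'.2 b (right_ne_zero_of_mul hne)
    have hab' : a + b = m := hab
    subst hab'
    rcases h3 with h3 | h3
    · rcases h4 with h4 | h4
      · left; rw [h3, h4]
      · right; rw [h3]; simpa using h4
    · right
      rcases h4 with h4 | h4
      · rw [h4]; simpa using h3
      · simp only [Finsupp.add_apply]; omega

theorem HasLead.one {N : ℕ} (z : Fin N) : HasLead z (1 : MvPolynomial (Fin N) ℂ) 0 := by
  classical
  refine ⟨by simp, ?_⟩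
  intro m hm
  left
  by_contra hne
  exact hm (by rw [coeff_one, if_neg (Ne.symm hne)])

theorem HasLead.pow {N : ℕ} {z : Fin N} {P : MvPolynomial (Fin N) ℂ} {q : Fin N →₀ ℕ}
    (h : HasLead z P q) (n : ℕ) : HasLead z (P ^ n) (n • q) := by
  induction n with
  | zero => simpa using HasLead.one z
  | succ n ih => rw [pow_succ, succ_nsmul]; exact ih.mul h

theorem HasLead.prod {N : ℕ} {z : Fin N} {ι : Type} (s : Finset ι)
    {P : ι → MvPolynomial (Fin N) ℂ} {q : ι → Fin N →₀ ℕ}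
    (h : ∀ i, HasLead z (P i) (q i)) : HasLead z (∏ i ∈ s, P i) (∑ i ∈ s, q i) := by
  classical
  induction s using Finset.induction_on with
  | empty => simpa using HasLead.one z
  | insert a s ha ih => rw [Finset.prod_insert ha, Finset.sum_insert ha]; exact (h a).mul ih

theorem HasLead.neg {N : ℕ} {z : Fin N} {P : MvPolynomial (Fin N) ℂ} {q : Fin N →₀ ℕ}
    (h : HasLead z P q) : HasLead z (-P) q := by
  refine ⟨by simpa using h.1, fun m hm => h.2 m (by simpa using hm)⟩

theorem HasLead.binomial {N : ℕ} {z : Fin N} {d e : Fin N →₀ ℕ} (h : e z < d z) :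
    HasLead z (monomial d (1 : ℂ) - monomial e 1) d := by
  classical
  have hne : e ≠ d := by rintro rfl; exact lt_irrefl _ h
  refine ⟨by simp [coeff_monomial, hne], ?_⟩
  intro m hm
  by_contra hc
  push Not at hc
  have h1 : d ≠ m := fun hh => hc.1 hh.symm
  have h2 : e ≠ m := by rintro rfl; omega
  exact hm (by simp [coeff_monomial, h1, h2])

theorem HasLead.linearIndependent {N : ℕ} {z : Fin N} {ι : Type*}
    {v : ι → MvPolynomial (Fin N) ℂ} {q : ι → Fin N →₀ ℕ} (hq : Function.Injective q)
    (h : ∀ i, HasLead z (v i) (q i)) : LinearIndependent ℂ v := by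
  classical
  rw [linearIndependent_iff']
  intro s c hs
  by_contra! hc
  obtain ⟨i, his, hi⟩ := hc
  obtain ⟨j, hj, hmax⟩ := Finset.exists_max_image (s.filter fun i => c i ≠ 0) (fun i => q i z)
    ⟨i, Finset.mem_filter.2 ⟨his, hi⟩⟩
  rw [Finset.mem_filter] at hj
  have h0 := congrArg (coeff (q j)) hs
  rw [coeff_sum, coeff_zero, Finset.sum_eq_single j] at h0
  · rw [coeff_smul, smul_eq_mul] at h0
    exact mul_ne_zero hj.2 (h j).1 h0
  · intro b hb hbj
    rw [coeff_smul, smul_eq_mul]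
    by_contra hne
    have hm := hmax b (Finset.mem_filter.2 ⟨hb, left_ne_zero_of_mul hne⟩)
    rcases (h b).2 _ (right_ne_zero_of_mul hne) with h3 | h3
    · exact hbj (hq h3.symm)
    · exact absurd h3 (not_lt.2 hm)
  · intro hn; exact absurd hj.1 hn

theorem X_dvd_mono {N : ℕ} (z : Fin N) (d : Fin N →₀ ℕ) :
    (X z : MvPolynomial (Fin N) ℂ) ∣ monomial d 1 ↔ d z ≠ 0 := by
  rw [X_dvd_monomial]
  simp

theorem statement9 (N : ℕ) (z : Fin N) (I : Type) [Fintype I] [DecidableEq I]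
    (f g : I → MvPolynomial (Fin N) ℂ)
    (hf : ∀ i, IsDeg2Monomial (f i)) (hg : ∀ i, IsDeg2Monomial (g i))
    (I₁ I₂ : Finset I) (hdisj : Disjoint I₁ I₂) (hunion : I₁ ∪ I₂ = Finset.univ)
    (h1 : ∀ i ∈ I₁, X z ∣ f i ∧ ¬ X z ∣ g i)
    (h2 : ∀ i ∈ I₂, X z ∣ g i ∧ ¬ X z ∣ f i)
    (k : ℕ) :
    ({Q : MvPolynomial (Fin N) ℂ | ∃ a : I → ℕ, (∑ i : I, a i) = k ∧
        Q = (∏ i ∈ I₁, f i ^ a i) * ∏ i ∈ I₂, g i ^ a i}).ncard ≤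
      Module.finrank ℂ ↥(Submodule.span ℂ
        {P : MvPolynomial (Fin N) ℂ | ∃ a : I → ℕ, (∑ i : I, a i) = k ∧
          P = ∏ i : I, (f i - g i) ^ a i}) := by
  classical
  choose d hd _ using hf
  choose e he _ using hg
  obtain rfl : f = fun i => monomial (d i) 1 := funext hd
  obtain rfl : g = fun i => monomial (e i) 1 := funext he
  simp only [X_dvd_mono, not_not] at h1 h2
  set q : I → Fin N →₀ ℕ := fun i => if i ∈ I₁ then d i else e i with hqdef
  have hlead : ∀ i, HasLead z (monomial (d i) (1 : ℂ) - monomial (e i) 1) (q i) := by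
    intro i
    by_cases hi : i ∈ I₁
    · have := h1 i hi
      simp only [hqdef, if_pos hi]
      exact HasLead.binomial (by omega)
    · have hi2 : i ∈ I₂ := by
        have : i ∈ I₁ ∪ I₂ := hunion ▸ Finset.mem_univ i
        exact (Finset.mem_union.1 this).resolve_left hi
      have := h2 i hi2
      simp only [hqdef, if_neg hi]
      rw [← neg_sub]
      exact (HasLead.binomial (by omega)).neg
  have hQ : ∀ a : I → ℕ, (∏ i ∈ I₁, (monomial (d i) (1 : ℂ)) ^ a i) *
      ∏ i ∈ I₂, (monomial (e i) (1 : ℂ)) ^ a i = monomial (∑ i, a i • q i) 1 := by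
    intro a
    have hA : ∏ i ∈ I₁, (monomial (d i) (1 : ℂ)) ^ a i = ∏ i ∈ I₁, monomial (a i • q i) 1 := by
      refine Finset.prod_congr rfl fun i hi => ?_
      simp only [hqdef, if_pos hi, monomial_pow, one_pow]
    have hB : ∏ i ∈ I₂, (monomial (e i) (1 : ℂ)) ^ a i = ∏ i ∈ I₂, monomial (a i • q i) 1 := by
      refine Finset.prod_congr rfl fun i hi => ?_
      have hi1 : i ∉ I₁ := fun h => Finset.disjoint_left.1 hdisj h hi
      simp only [hqdef, if_neg hi1, monomial_pow, one_pow]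
    rw [hA, hB, ← Finset.prod_union hdisj, hunion, monomial_sum_one]
  simp only [hQ]
  set S := {Q : MvPolynomial (Fin N) ℂ | ∃ a : I → ℕ, (∑ i : I, a i) = k ∧
    Q = monomial (∑ i, a i • q i) 1} with hS
  set T := {P : MvPolynomial (Fin N) ℂ | ∃ a : I → ℕ, (∑ i : I, a i) = k ∧
    P = ∏ i : I, (monomial (d i) (1 : ℂ) - monomial (e i) 1) ^ a i} with hT
  have hTfin : T.Finite := by
    have hfin : {a : I → ℕ | ∑ i, a i = k}.Finite := by
      refine (Set.finite_Iic (fun _ : I => k)).subset ?_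
      intro a ha i
      have ha' : ∑ i, a i = k := ha
      rw [← ha']
      exact Finset.single_le_sum (fun _ _ => Nat.zero_le _) (Finset.mem_univ i)
    refine (hfin.image fun a => ∏ i : I, (monomial (d i) (1 : ℂ) - monomial (e i) 1) ^ a i).subset ?_
    rintro P ⟨a, ha, rfl⟩
    exact ⟨a, ha, rfl⟩
  haveI : FiniteDimensional ℂ (Submodule.span ℂ T) := FiniteDimensional.span_of_finite ℂ hTfin
  have hch : ∀ Q : S, ∃ a : I → ℕ, (∑ i : I, a i) = k ∧
    (Q : MvPolynomial (Fin N) ℂ) = monomial (∑ i, a i • q i) 1 := fun Q => Q.2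
  choose a ha haQ using hch
  let v : S → Submodule.span ℂ T := fun Q =>
    ⟨∏ i : I, (monomial (d i) (1 : ℂ) - monomial (e i) 1) ^ a Q i,
      Submodule.subset_span ⟨a Q, ha Q, rfl⟩⟩
  have hli : LinearIndependent ℂ v := by
    apply LinearIndependent.of_comp (Submodule.span ℂ T).subtype
    refine HasLead.linearIndependent (z := z) (q := fun Q => ∑ i, a Q i • q i) ?_ ?_
    · intro Q Q' h
      apply Subtype.ext
      rw [haQ Q, haQ Q']
      exact congrArg (fun m => monomial m (1 : ℂ)) h
    · intro Q
      exact HasLead.prod Finset.univ fun i => (hlead i).pow (a Q i)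
  haveI : Finite S := hli.finite
  haveI := Fintype.ofFinite S
  have := hli.fintype_card_le_finrank
  rwa [← Nat.card_eq_fintype_card, Nat.card_coe_set_eq] at this
end

section
/- Fix an integer n ≥ 2 and a natural number k, and let T_k be the set of all polynomials ∏_{2≤p<t≤n} (x_p y_t − x_t y_p)^{g_{pt}} · ∏_{2≤t≤n} (x₁ x_t − y₁ y_t)^{g_{1t}} with natural numbers g_{pt} (1 ≤ p < t ≤ n) satisfying ∑_{1≤p<t≤n} g_{pt} = k. Define a weight w on monomials by giving x₁ and y₂,…,y_n weight 1 and all other variables weight 0, and a weight w′ by giving y₁ and x₂,…,x_n weight 1 and all other variables weight 0. Then every monomial occurring with nonzero coefficient in any element of T_k has w-weight k and w′-weight k. Consequently dim Span T_k ≤ C(n+k−1, n−1)², and hence there is a positive constant c depending only on n such that dim Span T_k ≤ c·k^{2n−2} for all k ≥ 1. -/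
open MvPolynomial

/-- The set `T_k` of products
`∏_{2≤p<t≤n} (x_p y_t − x_t y_p)^{g_{pt}} · ∏_{2≤t≤n} (x₁ x_t − y₁ y_t)^{g_{1t}}`
with `∑_{1≤p<t≤n} g_{pt} = k` (0-based: the pair `(p,t)` with `p.val = 0` gives the
factor `x₁ x_t − y₁ y_t`, all other pairs `p < t` give `x_p y_t − x_t y_p`). -/
noncomputable def Tset (n k : ℕ) : Set (MvPolynomial (Fin n ⊕ Fin n) ℂ) :=
  { P | ∃ g : Fin n → Fin n → ℕ,
      (∑ p : Fin n, ∑ t : Fin n, if p < t then g p t else 0) = k ∧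
      P = ∏ p : Fin n, ∏ t : Fin n,
        if p < t then
          (if p.val = 0 then xx n p * xx n t - yy n p * yy n t
           else xx n p * yy n t - xx n t * yy n p) ^ g p t
        else 1 }

/-- The weight `w`: `x₁` and `y₂, …, y_n` get weight 1, all other variables weight 0. -/
def w (n : ℕ) : Fin n ⊕ Fin n → ℕ :=
  Sum.elim (fun i => if i.val = 0 then 1 else 0) (fun i => if i.val = 0 then 0 else 1)

/-- The weight `w′`: `y₁` and `x₂, …, x_n` get weight 1, all other variables weight 0. -/
def w' (n : ℕ) : Fin n ⊕ Fin n → ℕ :=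
  Sum.elim (fun i => if i.val = 0 then 0 else 1) (fun i => if i.val = 0 then 1 else 0)

/-- Each element of `T_k` is weighted homogeneous for any weight giving each
of the quadratic factors weight one. -/
lemma Tset_hom (n k : ℕ) (u : Fin n ⊕ Fin n → ℕ)
    (h0 : ∀ p t : Fin n, p < t → p.val = 0 →
      u (Sum.inl p) + u (Sum.inl t) = 1 ∧ u (Sum.inr p) + u (Sum.inr t) = 1)
    (h1 : ∀ p t : Fin n, p < t → p.val ≠ 0 →
      u (Sum.inl p) + u (Sum.inr t) = 1 ∧ u (Sum.inl t) + u (Sum.inr p) = 1)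
    (P : MvPolynomial (Fin n ⊕ Fin n) ℂ) (hP : P ∈ Tset n k) :
    IsWeightedHomogeneous u P k := by
  obtain ⟨g, hg, rfl⟩ := hP
  rw [← hg]
  refine IsWeightedHomogeneous.prod _ _ _ fun p _ => ?_
  refine IsWeightedHomogeneous.prod _ _ _ fun t _ => ?_
  split_ifs with hpt hp
  · have := h0 p t hpt hp
    have hq : IsWeightedHomogeneous u (xx n p * xx n t - yy n p * yy n t) 1 := by
      refine IsWeightedHomogeneous.sub ?_ ?_
      · rw [← this.1]
        exact (isWeightedHomogeneous_X _ _ _).mul (isWeightedHomogeneous_X _ _ _)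
      · rw [← this.2]
        exact (isWeightedHomogeneous_X _ _ _).mul (isWeightedHomogeneous_X _ _ _)
    simpa using hq.pow (g p t)
  · have := h1 p t hpt hp
    have hq : IsWeightedHomogeneous u (xx n p * yy n t - xx n t * yy n p) 1 := by
      refine IsWeightedHomogeneous.sub ?_ ?_
      · rw [← this.1]
        exact (isWeightedHomogeneous_X _ _ _).mul (isWeightedHomogeneous_X _ _ _)
      · rw [← this.2]
        exact (isWeightedHomogeneous_X _ _ _).mul (isWeightedHomogeneous_X _ _ _)
    simpa using hq.pow (g p t)
  · exact isWeightedHomogeneous_one _ _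

lemma weight_eq_sum (n : ℕ) (u : Fin n ⊕ Fin n → ℕ) (d : Fin n ⊕ Fin n →₀ ℕ) :
    Finsupp.weight u d = ∑ v, u v * d v := by
  rw [Finsupp.weight_apply, Finsupp.sum_fintype _ _ (by simp)]
  simp [mul_comm]

lemma Tset_weights (n k : ℕ) : ∀ P ∈ Tset n k, ∀ d ∈ P.support,
    (∑ v : Fin n ⊕ Fin n, w n v * d v) = k ∧
    (∑ v : Fin n ⊕ Fin n, w' n v * d v) = k := by
  intro P hP d hd
  rw [mem_support_iff] at hd
  rw [← weight_eq_sum, ← weight_eq_sum]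
  constructor
  · refine Tset_hom n k (w n) ?_ ?_ P hP hd
    · intro p t hpt hp
      have : t.val ≠ 0 := by have : p.val < t.val := hpt; omega
      simp [w, hp, this]
    · intro p t hpt hp
      have : t.val ≠ 0 := by have : p.val < t.val := hpt; omega
      simp [w, hp, this]
  · refine Tset_hom n k (w' n) ?_ ?_ P hP hd
    · intro p t hpt hp
      have : t.val ≠ 0 := by have : p.val < t.val := hpt; omega
      simp [w', hp, this]
    · intro p t hpt hp
      have : t.val ≠ 0 := by have : p.val < t.val := hpt; omega
      simp [w', hp, this]

/-- The exponent vector assembled from its two parts of weight one. -/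
noncomputable def expo (n : ℕ) (ab : (Fin n →₀ ℕ) × (Fin n →₀ ℕ)) : Fin n ⊕ Fin n →₀ ℕ :=
  Finsupp.equivFunOnFinite.symm
    (Sum.elim (fun i => if i.val = 0 then ab.1 i else ab.2 i)
      (fun i => if i.val = 0 then ab.2 i else ab.1 i))

lemma Tset_finrank (n k : ℕ) (hn : 2 ≤ n) :
    Module.finrank ℂ ↥(Submodule.span ℂ (Tset n k)) ≤
      Nat.choose (n + k - 1) (n - 1) ^ 2 := by
  classical
  let A : Finset (Fin n →₀ ℕ) := Finset.finsuppAntidiag Finset.univ k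
  let S : Finset (MvPolynomial (Fin n ⊕ Fin n) ℂ) :=
    (A ×ˢ A).image fun ab => monomial (expo n ab) 1
  have hA : A.card = Nat.choose (n + k - 1) (n - 1) := by
    simp only [A, Finset.card_finsuppAntidiag_nat_eq_choose, Finset.card_univ, Fintype.card_fin]
    exact Nat.choose_symm_of_eq_add (by omega)
  have hS : S.card ≤ Nat.choose (n + k - 1) (n - 1) ^ 2 := by
    refine Finset.card_image_le.trans ?_
    rw [Finset.card_product, hA, sq]
  have hle : Submodule.span ℂ (Tset n k) ≤ Submodule.span ℂ (S : Set _) := by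
    rw [Submodule.span_le]
    intro P hP
    rw [SetLike.mem_coe, P.as_sum]
    refine Submodule.sum_mem _ fun d hd => ?_
    obtain ⟨hw, hw'⟩ := Tset_weights n k P hP d hd
    have hm : monomial d (coeff d P) = coeff d P • monomial d (1 : ℂ) := by
      rw [smul_monomial, smul_eq_mul, mul_one]
    rw [hm]
    refine Submodule.smul_mem _ _ (Submodule.subset_span ?_)
    rw [Finset.mem_coe, Finset.mem_image]
    refine ⟨(Finsupp.equivFunOnFinite.symm
        fun i => if i.val = 0 then d (Sum.inl i) else d (Sum.inr i),
      Finsupp.equivFunOnFinite.symm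
        fun i => if i.val = 0 then d (Sum.inr i) else d (Sum.inl i)), ?_, ?_⟩
    · simp only [A, Finset.mem_product, Finset.mem_finsuppAntidiag, Finset.subset_univ, and_true]
      constructor
      · rw [← hw, Fintype.sum_sum_type, ← Finset.sum_add_distrib]
        refine Finset.sum_congr rfl fun i _ => ?_
        by_cases hi : i.val = 0 <;> simp [w, hi]
      · rw [← hw', Fintype.sum_sum_type, ← Finset.sum_add_distrib]
        refine Finset.sum_congr rfl fun i _ => ?_
        by_cases hi : i.val = 0 <;> simp [w', hi]
    · refine congrArg (fun e => monomial e (1 : ℂ)) (Finsupp.ext fun v => ?_)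
      rcases v with i | i <;> by_cases hi : i.val = 0 <;> simp [expo, hi]
  have : Module.Finite ℂ (Submodule.span ℂ (S : Set (MvPolynomial (Fin n ⊕ Fin n) ℂ))) :=
    Module.Finite.span_finset ℂ S
  exact (Submodule.finrank_mono hle).trans ((finrank_span_finset_le_card S).trans hS)

theorem statement11 (n : ℕ) (hn : 2 ≤ n) (k : ℕ) :
    (∀ P ∈ Tset n k, ∀ d ∈ P.support,
        (∑ v : Fin n ⊕ Fin n, w n v * d v) = k ∧
        (∑ v : Fin n ⊕ Fin n, w' n v * d v) = k) ∧
    Module.finrank ℂ ↥(Submodule.span ℂ (Tset n k)) ≤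
      Nat.choose (n + k - 1) (n - 1) ^ 2 ∧
    ∃ c : ℝ, 0 < c ∧ ∀ k' : ℕ, 1 ≤ k' →
      (Module.finrank ℂ ↥(Submodule.span ℂ (Tset n k')) : ℝ) ≤
        c * (k' : ℝ) ^ (2 * n - 2) := by
  refine ⟨Tset_weights n k, Tset_finrank n k hn, (n : ℝ) ^ (2 * n - 2), by positivity, ?_⟩
  intro k' hk'
  have h1 := Tset_finrank n k' hn
  have h2 : Nat.choose (n + k' - 1) (n - 1) ≤ (n * k') ^ (n - 1) := by
    refine (Nat.choose_le_pow _ _).trans (Nat.pow_le_pow_left ?_ _)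
    obtain ⟨a, rfl⟩ := Nat.exists_eq_add_of_le hk'
    obtain ⟨b, rfl⟩ := Nat.exists_eq_add_of_le hn
    have : 2 + b + (1 + a) - 1 = 2 + b + a := by omega
    rw [this]
    nlinarith [Nat.zero_le (a * b)]
  have h3 := h1.trans (Nat.pow_le_pow_left h2 2)
  rw [← pow_mul, show (n - 1) * 2 = 2 * n - 2 by omega, mul_pow] at h3
  exact_mod_cast h3
end
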